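/- arXiv:1110.5174 — 7 statements merged into one kernel-verified Lean document; each statement's English description precedes it below -/
import Mathlib

section
/- Let N ≥ 1 and let x : ℤ/Nℤ → ℂ be a function that is not identically zero. Then ‖x‖₀ · ‖x̂‖₀ ≥ N, i.e. the product of the cardinality of the support of x and the cardinality of the support of its discrete Fourier transform is at least N. -/
/-- Discrete Fourier transform on `ℤ/Nℤ`:
`x̂(ω) = ∑_{t ∈ ℤ/Nℤ} x(t) · e^{-2πiωt/N}`. -/
noncomputable def dft {N : ℕ} [NeZero N] (x : ZMod N → ℂ) (ω : ZMod N) : ℂ :=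
  ∑ t : ZMod N,
    x t * Complex.exp (-(2 * Real.pi * Complex.I * (ω.val * t.val)) / N)

theorem dft_eq_zmodDFT {N : ℕ} [NeZero N] (x : ZMod N → ℂ) : dft x = ZMod.dft x := by
  funext ω
  rw [ZMod.dft_apply, dft]
  refine Finset.sum_congr rfl fun t _ ↦ ?_
  have h : -(t * ω) = ((-(t.val * ω.val : ℤ) : ℤ) : ZMod N) := by simp
  rw [h, ZMod.stdAddChar_coe, smul_eq_mul, mul_comm (x t)]
  congr 2
  push_cast
  ring

/-- The `ℓ^∞` bound for the discrete Fourier transform in terms of the support size. -/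
theorem norm_zmodDFT_le {N : ℕ} [NeZero N] (x : ZMod N → ℂ) {M : ℝ} (hM : ∀ t, ‖x t‖ ≤ M)
    (ω : ZMod N) : ‖ZMod.dft x ω‖ ≤ (Function.support x).ncard * M := by
  classical
  have hsupp : Function.support x = (Finset.univ.filter fun t ↦ x t ≠ 0 : Finset (ZMod N)) := by
    ext t
    simp
  rw [ZMod.dft_apply, hsupp, Set.ncard_coe_finset, ← nsmul_eq_mul]
  rw [← Finset.sum_filter_of_ne (p := fun t ↦ x t ≠ 0)
    fun t _ h ↦ right_ne_zero_of_smul h]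
  refine (norm_sum_le _ _).trans (Finset.sum_le_card_nsmul _ _ _ fun t _ ↦ ?_)
  simpa [norm_smul] using hM t

/-- If `x : ℤ/Nℤ → ℂ` is not identically zero, then
`‖x‖₀ · ‖x̂‖₀ ≥ N`. -/
theorem stmt_0 (N : ℕ) [NeZero N] (hN : 1 ≤ N) (x : ZMod N → ℂ) (hx : x ≠ 0) :
    N ≤ (Function.support x).ncard * (Function.support (dft x)).ncard := by
  obtain ⟨t₀, ht₀⟩ := Finite.exists_max fun t ↦ ‖x t‖
  have hpos : 0 < ‖x t₀‖ := by
    obtain ⟨t, ht⟩ := Function.ne_iff.mp hx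
    exact (norm_pos_iff.mpr ht).trans_le (ht₀ t)
  have h := norm_zmodDFT_le (ZMod.dft x) (norm_zmodDFT_le x ht₀) (-t₀)
  rw [ZMod.dft_dft] at h
  simp only [neg_neg, norm_smul, Complex.norm_natCast] at h
  rw [← mul_assoc, mul_le_mul_iff_left₀ hpos, mul_comm, ← dft_eq_zmodDFT] at h
  exact_mod_cast h
end

section
/- Let N ≥ 1, let x : ℤ/Nℤ → ℂ be supported on a set S of cardinality s ≥ 1, let r ∈ ℤ/Nℤ be a unit (i.e. its representative is coprime to N), and let t₀ ∈ ℤ/Nℤ. If x̂(t₀ + j·r) = 0 for all j = 0, 1, …, s−1, then x = 0. (In particular, a nonzero function supported on s points cannot have its Fourier transform vanish at s points of ℤ/Nℤ in arithmetic progression with unit common difference.) -/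
/-- The transform expressed through the standard additive character of `ZMod N`. -/
lemma dft_eq_sum_stdAddChar {N : ℕ} [NeZero N] (x : ZMod N → ℂ) (ω : ZMod N) :
    dft x ω = ∑ t : ZMod N, x t * ZMod.stdAddChar (-(ω * t)) := by
  refine Finset.sum_congr rfl fun t _ => ?_
  have h : -(ω * t) = ((-((ω.val : ℤ) * (t.val : ℤ)) : ℤ) : ZMod N) := by
    push_cast
    simp only [ZMod.natCast_zmod_val]
  rw [h, ZMod.stdAddChar_coe]
  congr 2
  push_cast
  ring

/-- A vector whose first `S.card` power moments at distinct nodes vanish is zero. -/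
lemma eq_zero_of_forall_sum_mul_pow_eq_zero {ι R : Type*} [CommRing R] [IsDomain R]
    (S : Finset ι) {f v : ι → R} (hf : Set.InjOn f S)
    (h : ∀ j < S.card, ∑ i ∈ S, v i * f i ^ j = 0) : ∀ i ∈ S, v i = 0 := by
  let e := S.equivFin
  have hv : (fun k => v (e.symm k)) = 0 := by
    refine Matrix.eq_zero_of_forall_pow_sum_mul_pow_eq_zero
      (f := fun k => f (e.symm k)) (fun a b hab => ?_) (fun j => ?_)
    · exact e.symm.injective (Subtype.ext (hf (e.symm a).2 (e.symm b).2 hab))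
    · rw [← h j j.2, ← Finset.sum_coe_sort S]
      exact e.symm.sum_comp fun i : S => v i * f i ^ (j : ℕ)
  intro i hi
  simpa using congrFun hv (e ⟨i, hi⟩)

/-- If `x` is supported on a set `S` of cardinality `s ≥ 1` and `x̂` vanishes at the
`s` points `t₀, t₀ + r, …, t₀ + (s-1)r` of an arithmetic progression whose common
difference `r` is a unit, then `x = 0`. -/
theorem stmt_1 (N : ℕ) [NeZero N] (hN : 1 ≤ N) (x : ZMod N → ℂ)
    (S : Finset (ZMod N)) (hsupp : ∀ t ∉ S, x t = 0) (hs : 1 ≤ S.card)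
    (r : ZMod N) (hr : IsUnit r) (t₀ : ZMod N)
    (hzero : ∀ j : ℕ, j < S.card → dft x (t₀ + (j : ZMod N) * r) = 0) :
    x = 0 := by
  have key : ∀ t ∈ S, x t * ZMod.stdAddChar (-(t₀ * t)) = 0 := by
    refine eq_zero_of_forall_sum_mul_pow_eq_zero S
      (f := fun t : ZMod N => ZMod.stdAddChar (-(r * t))) (fun a _ b _ hab => ?_) (fun j hj => ?_)
    · exact hr.mul_left_cancel (neg_injective (ZMod.injective_stdAddChar hab))
    · rw [← hzero j hj, dft_eq_sum_stdAddChar,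
        ← Finset.sum_subset S.subset_univ fun t _ ht => by rw [hsupp t ht, zero_mul]]
      refine Finset.sum_congr rfl fun t _ => ?_
      rw [← AddChar.map_nsmul_eq_pow, mul_assoc, ← AddChar.map_add_eq_mul, nsmul_eq_mul]
      congr 2
      ring
  funext t
  by_cases ht : t ∈ S
  · refine (mul_eq_zero.mp (key t ht)).resolve_right ?_
    rw [ZMod.stdAddChar_apply]
    exact Circle.coe_ne_zero _
  · exact hsupp t ht
end

section
/- Let S ⊆ ℤ and let z : ℤ → ℂ be summable (∑_{n∈ℤ}|z_n| < ∞) with z not identically zero. Then the following are equivalent: (a) for every summable x : ℤ → ℂ supported on S, ∑_{n∈S}|x_n + z_n| + ∑_{n∉S}|z_n| > ∑_{n∈S}|x_n|; (b) ∑_{n∉S}|z_n| > ∑_{n∈S}|z_n|. -/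
/-- For a summable `z : ℤ → ℂ`, not identically zero, and `S ⊆ ℤ`, the following are
equivalent: (a) for every summable `x` supported on `S`,
`∑_{n∈S}|x_n + z_n| + ∑_{n∉S}|z_n| > ∑_{n∈S}|x_n|`;
(b) `∑_{n∉S}|z_n| > ∑_{n∈S}|z_n|`. -/
theorem stmt_4 (S : Set ℤ) (z : ℤ → ℂ) (hz : Summable fun n => ‖z n‖) (hz0 : z ≠ 0) :
    (∀ x : ℤ → ℂ, (Summable fun n => ‖x n‖) → (∀ n ∉ S, x n = 0) →
      (∑' n : S, ‖x (n : ℤ)‖) <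
        (∑' n : S, ‖x (n : ℤ) + z (n : ℤ)‖) + ∑' n : ↥Sᶜ, ‖z (n : ℤ)‖) ↔
    (∑' n : S, ‖z (n : ℤ)‖) < ∑' n : ↥Sᶜ, ‖z (n : ℤ)‖ := by
  constructor
  · intro h
    have hx := h (S.indicator (-z))
      ((hz.indicator S).congr fun n => by by_cases hn : n ∈ S <;> simp [hn])
      (fun n hn => Set.indicator_of_notMem hn _)
    simpa using hx
  · intro h x hx _
    have hxS : Summable fun n : S => ‖x n‖ := hx.subtype S
    have hzS : Summable fun n : S => ‖z n‖ := hz.subtype S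
    have hxzS : Summable fun n : S => ‖x n + z n‖ :=
      (hxS.add hzS).of_nonneg_of_le (fun _ => norm_nonneg _) fun _ => norm_add_le _ _
    have key : ∑' n : S, ‖x n‖ ≤ ∑' n : S, ‖x n + z n‖ + ∑' n : S, ‖z n‖ := by
      rw [← hxzS.tsum_add hzS]
      exact hxS.tsum_le_tsum (fun n => norm_le_add_norm_add (x n) (z n)) (hxzS.add hzS)
    linarith
end

section
/- Let S ⊆ ℤ have step at least d (i.e. |s − s'| ≥ d for all distinct s, s' ∈ S) and let 0 < r < 1/2. Assume that at least one of the following holds: (i) r < 1/10 and d > (5/r)·log(1/r), or (ii) d > 10 and r > (5/d)·log d. Then every summable z : ℤ → ℂ, not identically zero, such that ∑_{n∈ℤ} z_n·e^{2πint} = 0 for all real t with |t| ≤ r, satisfies ∑_{n∉S}|z_n| > ∑_{n∈S}|z_n|. -/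
open Real

theorem abs_sinc_le_of_le_one {y : ℝ} (h0 : 0 < y) (h1 : y ≤ 1) : |sinc y| ≤ 1 - y ^ 2 / 9 := by
  have hb := abs_le.1 (Real.sin_bound (x := y) (by rwa [abs_of_pos h0]))
  rw [abs_of_pos h0] at hb
  have hs : 0 < sin y := sin_pos_of_pos_of_lt_pi h0 (by linarith [pi_gt_three])
  rw [sinc_of_ne_zero h0.ne', abs_of_pos (div_pos hs h0), div_le_iff₀ h0]
  have h5 : y ^ 5 ≤ y ^ 3 := pow_le_pow_of_le_one h0.le h1 (by norm_num)
  have h3 : 0 < y ^ 3 := by positivity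
  nlinarith [hb.2]

theorem abs_sinc_le_inv_abs {y : ℝ} (hy : y ≠ 0) : |sinc y| ≤ |y|⁻¹ := by
  rw [sinc_of_ne_zero hy, abs_div, div_eq_mul_inv]
  exact mul_le_of_le_one_left (by positivity) (abs_sin_le_one y)

theorem abs_sinc_le_abs_sinc_half (y : ℝ) : |sinc y| ≤ |sinc (y / 2)| := by
  rcases eq_or_ne y 0 with rfl | hy
  · simp
  have h : sinc y = sinc (y / 2) * cos (y / 2) := by
    rw [sinc_of_ne_zero hy, sinc_of_ne_zero (by positivity)]
    have := sin_two_mul (y / 2)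
    rw [mul_div_cancel₀ y two_ne_zero] at this
    rw [this]; field_simp
  rw [h, abs_mul]
  exact mul_le_of_le_one_right (abs_nonneg _) (abs_cos_le_one _)

theorem abs_sinc_le_of_le {y₀ y : ℝ} (h0 : 0 < y₀) (h1 : y₀ ≤ 1 / 2) (hy : y₀ ≤ |y|) :
    |sinc y| ≤ 1 - y₀ ^ 2 / 9 := by
  wlog hpos : 0 ≤ y generalizing y
  · simpa using this (y := -y) (by simpa using hy) (by linarith)
  rw [abs_of_nonneg hpos] at hy
  rcases le_or_gt y 1 with hy1 | hy1
  · refine (abs_sinc_le_of_le_one (h0.trans_le hy) hy1).trans ?_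
    gcongr
  rcases le_or_gt y 2 with hy2 | hy2
  · refine (abs_sinc_le_abs_sinc_half y).trans ?_
    refine (abs_sinc_le_of_le_one (y := y / 2) (by linarith) (by linarith)).trans ?_
    gcongr
    linarith
  · refine (abs_sinc_le_inv_abs (by linarith)).trans ?_
    rw [abs_of_nonneg hpos]
    have : y⁻¹ ≤ 2⁻¹ := inv_anti₀ (by norm_num) hy2.le
    nlinarith

theorem four_mul_sq_le_two_pow {p : ℕ} (hp : 8 ≤ p) : 4 * p ^ 2 ≤ 2 ^ p := by
  induction p, hp using Nat.le_induction with
  | base => norm_num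
  | succ p hp ih => rw [pow_succ 2]; nlinarith

theorem exists_natCast_scale {r d : ℝ} (hr0 : 0 < r)
    (hcond : (r < 1 / 10 ∧ d > 5 / r * Real.log (1 / r)) ∨
             (d > 10 ∧ r > 5 / d * Real.log d)) :
    0 < d ∧ ∃ p : ℕ, 11 ≤ p ∧ (p : ℝ) ≤ r * d ∧ (2 / 3 : ℝ) ^ (p + 1) ≤ r ^ 2 := by
  obtain ⟨ε, hε0, hε1, hεr, hd⟩ : ∃ ε : ℝ, 0 < ε ∧ ε < 1 / 10 ∧ ε ≤ r ∧ 5 * log (1 / ε) < r * d := by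
    rcases hcond with ⟨h1, h2⟩ | ⟨h1, h2⟩
    · refine ⟨r, hr0, h1, le_rfl, ?_⟩
      have := mul_lt_mul_of_pos_left h2 hr0
      calc _ = r * (5 / r * log (1 / r)) := by field_simp
        _ < _ := this
    · have hd0 : 0 < d := by linarith
      have hl : 1 ≤ log d := by
        rw [le_log_iff_exp_le hd0]
        linarith [exp_one_lt_d9]
      refine ⟨1 / d, by positivity, one_div_lt_one_div_of_lt (by norm_num) h1, ?_, ?_⟩
      · refine le_trans ?_ h2.le
        rw [div_mul_eq_mul_div]
        gcongr
        linarith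
      · rw [one_div_one_div]
        have := mul_lt_mul_of_pos_right h2 hd0
        calc _ = 5 / d * log d * d := by field_simp
          _ < _ := this
  have hL : 11 / 5 < log (1 / ε) := by
    rw [lt_log_iff_exp_lt (by positivity)]
    have h10 : (10 : ℝ) < 1 / ε := by rw [lt_one_div (by norm_num) hε0]; exact hε1
    refine lt_trans (lt_of_pow_lt_pow_left₀ 5 (by norm_num) ?_) h10
    rw [← exp_nat_mul]
    calc exp ((5 : ℕ) * (11 / 5)) = exp 1 ^ 11 := by rw [← exp_nat_mul]; norm_num
      _ ≤ 2.7182818286 ^ 11 := by gcongr; exact exp_one_lt_d9.le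
      _ < 10 ^ 5 := by norm_num
  refine ⟨?_, ⌊5 * log (1 / ε)⌋₊, Nat.le_floor (by push_cast; linarith),
    (Nat.floor_le (by linarith)).trans hd.le, ?_⟩
  · have : 0 < r * d := by linarith
    exact pos_of_mul_pos_right this hr0.le
  · set p := ⌊5 * log (1 / ε)⌋₊
    have hp : 5 * log (1 / ε) < p + 1 := Nat.lt_floor_add_one _
    have h23 : (2 / 3 : ℝ) ≤ exp (-(2 / 5)) := by
      rw [exp_neg, le_inv_comm₀ (by norm_num) (exp_pos _)]
      refine le_of_pow_le_pow_left₀ (n := 5) (by norm_num) (by norm_num) ?_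
      rw [← exp_nat_mul]
      calc exp ((5 : ℕ) * (2 / 5)) = exp 1 ^ 2 := by rw [← exp_nat_mul]; norm_num
        _ ≤ 2.7182818286 ^ 2 := by gcongr; exact exp_one_lt_d9.le
        _ ≤ _ := by norm_num
    calc (2 / 3 : ℝ) ^ (p + 1) ≤ exp (-(2 / 5)) ^ (p + 1) := by gcongr
      _ = exp (-(2 / 5) * (p + 1)) := by rw [← exp_nat_mul]; push_cast; ring_nf
      _ ≤ exp (2 * log ε) := by
        rw [exp_le_exp]
        rw [one_div, log_inv] at hp
        linarith
      _ = ε ^ 2 := by rw [two_mul, exp_add, exp_log hε0, sq]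
      _ ≤ r ^ 2 := by gcongr

theorem integral_exp_mul_I_symm (θ : ℝ) {h : ℝ} (h0 : 0 < h) :
    ∫ s in (-h)..h, Complex.exp (θ * Complex.I * s) = 2 * h * sinc (θ * h) := by
  rcases eq_or_ne θ 0 with rfl | hθ
  · simp; ring
  have hθ' : (θ : ℂ) ≠ 0 := by exact_mod_cast hθ
  have hh' : (h : ℂ) ≠ 0 := by exact_mod_cast h0.ne'
  rw [integral_exp_mul_complex (by simp [hθ]), sinc_of_ne_zero (by positivity)]
  push_cast
  rw [Complex.sin]
  have e1 : -((θ : ℂ) * h) * Complex.I = θ * Complex.I * (-h) := by ring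
  have e2 : ((θ : ℂ) * h) * Complex.I = θ * Complex.I * h := by ring
  rw [e1, e2]
  field_simp
  rw [Complex.I_sq]
  ring

theorem norm_exp_fourier (n : ℤ) (t : ℝ) :
    ‖Complex.exp (2 * π * Complex.I * (n : ℂ) * (t : ℂ))‖ = 1 := by
  have : 2 * π * Complex.I * (n : ℂ) * (t : ℂ) = ((2 * π * n * t : ℝ) : ℂ) * Complex.I := by
    push_cast; ring
  rw [this, Complex.norm_exp_ofReal_mul_I]

theorem tsum_mul_sinc_mul_exp_eq_zero {z : ℤ → ℂ} (hz : Summable fun n => ‖z n‖) {R h : ℝ}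
    (h0 : 0 < h)
    (hvanish : ∀ t : ℝ, |t| ≤ R →
      (∑' n : ℤ, z n * Complex.exp (2 * π * Complex.I * (n : ℂ) * (t : ℂ))) = 0)
    (t : ℝ) (ht : |t| ≤ R - h) :
    ∑' n : ℤ, z n * sinc (2 * π * h * n) *
      Complex.exp (2 * π * Complex.I * (n : ℂ) * (t : ℂ)) = 0 := by
  have key := intervalIntegral.hasSum_integral_of_dominated_convergence (μ := MeasureTheory.volume)
    (a := -h) (b := h)
    (F := fun (n : ℤ) (s : ℝ) => z n * Complex.exp (2 * π * Complex.I * (n : ℂ) * ((t + s : ℝ) : ℂ)))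
    (f := fun _ => 0) (fun n _ => ‖z n‖)
    (fun n => by
      apply Continuous.aestronglyMeasurable
      fun_prop)
    (fun n => by
      filter_upwards with s _
      rw [norm_mul, norm_exp_fourier, mul_one])
    (by filter_upwards with s _; exact hz)
    (by simp)
    (by
      filter_upwards with s hs
      rw [Set.uIoc_of_le (by linarith)] at hs
      have hs' : |t + s| ≤ R := by
        have : |s| ≤ h := abs_le.2 ⟨hs.1.le, hs.2⟩
        linarith [abs_add_le t s]
      rw [← hvanish _ hs']
      refine Summable.hasSum (Summable.of_norm ?_)
      simpa only [norm_mul, norm_exp_fourier, mul_one] using hz)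
  have hterm (n : ℤ) : (∫ s in (-h)..h,
      z n * Complex.exp (2 * π * Complex.I * (n : ℂ) * ((t + s : ℝ) : ℂ))) =
      2 * h * (z n * sinc (2 * π * h * n) *
        Complex.exp (2 * π * Complex.I * (n : ℂ) * (t : ℂ))) := by
    have := integral_exp_mul_I_symm (2 * π * n) h0
    have e (s : ℝ) : z n * Complex.exp (2 * π * Complex.I * (n : ℂ) * ((t + s : ℝ) : ℂ)) =
        z n * Complex.exp (2 * π * Complex.I * (n : ℂ) * (t : ℂ)) *
          Complex.exp ((2 * π * n : ℝ) * Complex.I * s) := by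
      rw [mul_assoc (z n), ← Complex.exp_add]
      congr 2
      push_cast; ring
    simp only [e]
    rw [intervalIntegral.integral_const_mul, this, mul_right_comm (2 * π) h]
    ring
  simp only [hterm, intervalIntegral.integral_zero] at key
  have := key.tsum_eq
  rw [tsum_mul_left] at this
  have hh' : (h : ℂ) ≠ 0 := by exact_mod_cast h0.ne'
  simpa [hh'] using this

theorem tsum_mul_sinc_pow_mul_exp_eq_zero {z : ℤ → ℂ} (hz : Summable fun n => ‖z n‖) {R h : ℝ}
    (h0 : 0 < h)
    (hvanish : ∀ t : ℝ, |t| ≤ R →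
      (∑' n : ℤ, z n * Complex.exp (2 * π * Complex.I * (n : ℂ) * (t : ℂ))) = 0)
    (p : ℕ) (t : ℝ) (ht : |t| ≤ R - p * h) :
    ∑' n : ℤ, z n * sinc (2 * π * h * n) ^ p *
      Complex.exp (2 * π * Complex.I * (n : ℂ) * (t : ℂ)) = 0 := by
  induction p generalizing t with
  | zero => simpa using hvanish t (by simpa using ht)
  | succ p ih =>
    have hs : Summable fun n : ℤ => ‖z n * sinc (2 * π * h * n) ^ p‖ := by
      refine hz.of_nonneg_of_le (fun _ => norm_nonneg _) fun n => ?_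
      rw [norm_mul, norm_pow, Complex.norm_real, Real.norm_eq_abs]
      exact mul_le_of_le_one_right (norm_nonneg _) (pow_le_one₀ (abs_nonneg _) (abs_sinc_le_one _))
    have := tsum_mul_sinc_mul_exp_eq_zero hs h0 ih t (by push_cast at ht; linarith)
    simpa only [pow_succ, mul_assoc] using this

theorem tsum_mul_sinc_pow_shift_eq_zero {z : ℤ → ℂ} (hz : Summable fun n => ‖z n‖) {R : ℝ}
    (hR : 0 < R)
    (hvanish : ∀ t : ℝ, |t| ≤ R →
      (∑' n : ℤ, z n * Complex.exp (2 * π * Complex.I * (n : ℂ) * (t : ℂ))) = 0)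
    {p : ℕ} (hp : 0 < p) (m : ℤ) :
    ∑' n : ℤ, z n * ((sinc (2 * π * (R / p) * (n - m : ℤ)) ^ p : ℝ) : ℂ) = 0 := by
  have hs : Summable fun n : ℤ => ‖z (n + m)‖ := (Equiv.addRight m).summable_iff.2 hz
  have hv (t : ℝ) (ht : |t| ≤ R) :
      (∑' n : ℤ, z (n + m) * Complex.exp (2 * π * Complex.I * (n : ℂ) * (t : ℂ))) = 0 := by
    have e (n : ℤ) : z (n + m) * Complex.exp (2 * π * Complex.I * (n : ℂ) * (t : ℂ)) =
        z (n + m) * Complex.exp (2 * π * Complex.I * ((n + m : ℤ) : ℂ) * (t : ℂ)) *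
          Complex.exp (-(2 * π * Complex.I * (m : ℂ) * (t : ℂ))) := by
      rw [mul_assoc (z _), ← Complex.exp_add]
      congr 2
      push_cast; ring
    have hsum := (Equiv.addRight m).tsum_eq
      (fun n => z n * Complex.exp (2 * π * Complex.I * (n : ℂ) * (t : ℂ)))
    simp only [Equiv.coe_addRight] at hsum
    simp only [e]
    rw [tsum_mul_right, hsum, hvanish t ht, zero_mul]
  have hp' : (0 : ℝ) < p := by exact_mod_cast hp
  have := tsum_mul_sinc_pow_mul_exp_eq_zero hs (div_pos hR hp') hv p 0
    (by rw [mul_div_cancel₀ _ hp'.ne']; simp)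
  rw [← (Equiv.addRight m).tsum_eq]
  simpa using this

theorem hasSum_ite_one_div_sq (a Q : ℝ) :
    HasSum (fun j : ℤ => if j = 0 then a else Q / (j : ℝ) ^ 2) (a + Q * (π ^ 2 / 3)) := by
  have h (s : ℤ → ℤ) (hs : ∀ n : ℕ, ((s n : ℤ) : ℝ) ^ 2 = (n : ℝ) ^ 2) :
      HasSum (fun n : ℕ => Q / ((s n : ℤ) : ℝ) ^ 2) (Q * (π ^ 2 / 6)) := by
    simpa only [hs, mul_one_div] using hasSum_zeta_two.mul_left Q
  have h2 : HasSum (fun j : ℤ => Q / (j : ℝ) ^ 2) (Q * (π ^ 2 / 3)) := by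
    have := HasSum.of_nat_of_neg (f := fun j : ℤ => Q / (j : ℝ) ^ 2)
      (h (fun j => j) (by simp)) (h (fun j => -j) (by simp))
    have e : Q * (π ^ 2 / 6) + Q * (π ^ 2 / 6) - Q / ((0 : ℤ) : ℝ) ^ 2 = Q * (π ^ 2 / 3) := by
      simp
      ring
    rwa [e] at this
  have h1 := (hasSum_ite_eq (0 : ℤ) a).add h2
  have he : (fun j : ℤ => if j = 0 then a else Q / (j : ℝ) ^ 2) =
      fun j : ℤ => (if j = 0 then a else 0) + Q / (j : ℝ) ^ 2 := by
    funext j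
    by_cases hj : j = 0 <;> simp [hj]
  rwa [he]

theorem round_div_sub_injOn {S : Set ℤ} {d : ℝ} (hd : 0 < d)
    (hstep : ∀ s ∈ S, ∀ s' ∈ S, s ≠ s' → d ≤ |((s : ℝ) - (s' : ℝ))|) (n : ℤ) :
    Set.InjOn (fun m : ℤ => round (((n - m : ℤ) : ℝ) / d)) S := by
  intro a ha b hb hab
  by_contra hne
  have h1 := hstep a ha b hb hne
  dsimp only at hab
  obtain ⟨j, hj⟩ : ∃ j, round (((n - b : ℤ) : ℝ) / d) = j := ⟨_, rfl⟩
  have ha' := round_eq_iff.1 (hab.trans hj)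
  have hb' := round_eq_iff.1 hj
  simp only [Set.mem_Ico, le_div_iff₀ hd, div_lt_iff₀ hd, Int.cast_sub] at ha' hb'
  have : |(a : ℝ) - b| < d := by
    rw [abs_lt]
    constructor <;> nlinarith [ha'.1, ha'.2, hb'.1, hb'.2]
  linarith

theorem abs_round_div_mul_le {d : ℝ} (hd : 0 < d) (x : ℝ) :
    |(round (x / d) : ℝ)| * d / 2 ≤ |x| := by
  have h := abs_sub_round (x / d)
  rcases eq_or_ne (round (x / d)) 0 with h0 | h0
  · simp [h0]
  have h1 : (1 : ℝ) ≤ |(round (x / d) : ℝ)| := by exact_mod_cast Int.one_le_abs h0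
  have h2 : |(round (x / d) : ℝ)| ≤ |x / d| + 1 / 2 := by
    have := abs_sub_abs_le_abs_sub (round (x / d) : ℝ) (x / d)
    rw [abs_sub_comm] at this
    linarith
  have h3 : |(round (x / d) : ℝ)| / 2 ≤ |x / d| := by linarith
  rw [abs_div, abs_of_pos hd, le_div_iff₀ hd] at h3
  linarith

open scoped ENNReal

theorem tsum_enorm_kernel_le {S : Set ℤ} {d : ℝ} (hd : 0 < d)
    (hstep : ∀ s ∈ S, ∀ s' ∈ S, s ≠ s' → d ≤ |((s : ℝ) - (s' : ℝ))|)
    {K : ℤ → ℝ} {Q : ℝ} (hQ0 : 0 ≤ Q)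
    (hQ : ∀ x j : ℤ, j ≠ 0 → |(j : ℝ)| * d / 2 ≤ |(x : ℝ)| → |K x| ≤ Q / (j : ℝ) ^ 2)
    {a : ℝ} (ha : 0 ≤ a) (n : ℤ)
    (hnear : ∀ m ∈ S, m ≠ n → |((n - m : ℤ) : ℝ)| ≤ d / 2 → |K (n - m)| ≤ a) :
    ∑' m : S, (if n = m then 0 else ‖K (n - m)‖ₑ) ≤ ENNReal.ofReal (a + Q * (π ^ 2 / 3)) := by
  have hf (j : ℤ) : 0 ≤ (if j = 0 then a else Q / (j : ℝ) ^ 2) := by split_ifs <;> positivity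
  rw [← (hasSum_ite_one_div_sq a Q).tsum_eq,
    ENNReal.ofReal_tsum_of_nonneg hf (hasSum_ite_one_div_sq a Q).summable]
  refine le_trans (ENNReal.tsum_le_tsum fun m => ?_) (ENNReal.tsum_comp_le_tsum_of_injective
    (round_div_sub_injOn hd hstep n).injective _)
  by_cases hnm : n = m
  · rw [if_pos hnm]
    exact zero_le
  rw [if_neg hnm]
  rw [Real.enorm_eq_ofReal_abs]
  refine ENNReal.ofReal_le_ofReal ?_
  change _ ≤ if round (((n - m : ℤ) : ℝ) / d) = 0 then a else
    Q / (round (((n - m : ℤ) : ℝ) / d) : ℝ) ^ 2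
  split_ifs with hj
  · refine hnear m m.2 (Ne.symm hnm) ?_
    have := abs_sub_round (((n - m : ℤ) : ℝ) / d)
    rw [hj, Int.cast_zero, sub_zero, abs_div, abs_of_pos hd, div_le_iff₀ hd] at this
    linarith
  · exact hQ _ _ hj (abs_round_div_mul_le hd _)

theorem enorm_le_tsum_of_tsum_mul_kernel_eq_zero {z : ℤ → ℂ} (hz : Summable fun n => ‖z n‖)
    {K : ℤ → ℝ} (hK0 : K 0 = 1) (hK : ∀ x, |K x| ≤ 1) (m : ℤ)
    (h : ∑' n : ℤ, z n * (K (n - m) : ℂ) = 0) :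
    ‖z m‖ₑ ≤ ∑' n : ℤ, ‖z n‖ₑ * (if n = m then 0 else ‖K (n - m)‖ₑ) := by
  have hs : Summable fun n : ℤ => z n * (K (n - m) : ℂ) := by
    refine Summable.of_norm (hz.of_nonneg_of_le (fun _ => norm_nonneg _) fun n => ?_)
    rw [norm_mul, Complex.norm_real]
    exact mul_le_of_le_one_right (norm_nonneg _) (hK _)
  rw [hs.tsum_eq_add_tsum_ite m, sub_self, hK0, Complex.ofReal_one, mul_one] at h
  rw [eq_neg_of_add_eq_zero_left h, enorm_neg]
  refine enorm_tsum_le_tsum_enorm.trans (ENNReal.tsum_le_tsum fun n => ?_)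
  split_ifs
  · simp
  · rw [enorm_mul, ← enorm_norm (K (n - m) : ℂ), Complex.norm_real, enorm_norm]

theorem tsum_norm_lt_tsum_norm_compl {S : Set ℤ} {d : ℝ} (hd : 0 < d)
    (hstep : ∀ s ∈ S, ∀ s' ∈ S, s ≠ s' → d ≤ |((s : ℝ) - (s' : ℝ))|)
    {z : ℤ → ℂ} (hz : Summable fun n => ‖z n‖) (hz0 : z ≠ 0)
    {K : ℤ → ℝ} (hK0 : K 0 = 1) {Q u : ℝ} (hu1 : u ≤ 1)
    (hK : ∀ x, x ≠ 0 → |K x| ≤ 1 - u) (hQ0 : 0 ≤ Q)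
    (hQ : ∀ x j : ℤ, j ≠ 0 → |(j : ℝ)| * d / 2 ≤ |(x : ℝ)| → |K x| ≤ Q / (j : ℝ) ^ 2)
    (hQu : 2 * (Q * (π ^ 2 / 3)) < u)
    (h : ∀ m : ℤ, ∑' n : ℤ, z n * (K (n - m) : ℂ) = 0) :
    (∑' n : S, ‖z (n : ℤ)‖) < ∑' n : ↥Sᶜ, ‖z (n : ℤ)‖ := by
  set T := Q * (π ^ 2 / 3) with hT
  have hT0 : 0 ≤ T := by positivity
  have hKle (x : ℤ) : |K x| ≤ 1 := by
    rcases eq_or_ne x 0 with rfl | hx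
    · simp [hK0]
    · linarith [hK x hx]
  set X := ∑' n : S, ‖z (n : ℤ)‖ with hX
  set Y := ∑' n : ↥Sᶜ, ‖z (n : ℤ)‖ with hY
  have hX0 : 0 ≤ X := tsum_nonneg fun _ => norm_nonneg _
  have hY0 : 0 ≤ Y := tsum_nonneg fun _ => norm_nonneg _
  have hXe : ∑' n : S, ‖z n‖ₑ = ENNReal.ofReal X := by
    refine Eq.trans ?_ (ENNReal.ofReal_tsum_of_nonneg (f := fun n : S => ‖z n‖)
      (fun _ => norm_nonneg _) (hz.subtype S)).symm
    simp
  have hYe : ∑' n : ↥Sᶜ, ‖z n‖ₑ = ENNReal.ofReal Y := by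
    refine Eq.trans ?_ (ENNReal.ofReal_tsum_of_nonneg (f := fun n : ↥Sᶜ => ‖z n‖)
      (fun _ => norm_nonneg _) (hz.subtype Sᶜ)).symm
    simp
  have hXY : 0 < X + Y := by
    rw [hX, hY, hz.tsum_subtype_add_tsum_subtype_compl S]
    obtain ⟨n, hn⟩ := Function.ne_iff.1 hz0
    exact hz.tsum_pos (fun _ => norm_nonneg _) n (norm_pos_iff.2 hn)
  have main : X ≤ X * T + Y * (1 - u + T) := by
    have hr : 0 ≤ X * T + Y * (1 - u + T) := by
      have : 0 ≤ 1 - u + T := by linarith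
      positivity
    rw [← ENNReal.ofReal_le_ofReal_iff hr]
    calc ENNReal.ofReal X
        ≤ ∑' m : S, ∑' n : ℤ, ‖z n‖ₑ * (if n = m then 0 else ‖K (n - m)‖ₑ) := by
          rw [← hXe]
          exact ENNReal.tsum_le_tsum fun m =>
            enorm_le_tsum_of_tsum_mul_kernel_eq_zero hz hK0 hKle m (h m)
      _ = ∑' n : ℤ, ‖z n‖ₑ * ∑' m : S, (if n = m then 0 else ‖K (n - m)‖ₑ) := by
          rw [ENNReal.tsum_comm]
          simp only [ENNReal.tsum_mul_left]
      _ = ∑' n : S, ‖z n‖ₑ * ∑' m : S, (if (n : ℤ) = m then 0 else ‖K (n - m)‖ₑ) +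
          ∑' n : ↥Sᶜ, ‖z n‖ₑ * ∑' m : S, (if (n : ℤ) = m then 0 else ‖K (n - m)‖ₑ) :=
          (ENNReal.summable.tsum_add_tsum_compl (s := S) ENNReal.summable).symm
      _ ≤ ∑' n : S, ‖z n‖ₑ * ENNReal.ofReal (0 + T) +
          ∑' n : ↥Sᶜ, ‖z n‖ₑ * ENNReal.ofReal (1 - u + T) := by
          gcongr with n n
          · refine tsum_enorm_kernel_le hd hstep hQ0 hQ le_rfl n fun m hm hmn hle => ?_
            have := hstep n n.2 m hm hmn.symm
            push_cast at hle
            linarith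
          · refine tsum_enorm_kernel_le hd hstep hQ0 hQ (by linarith) n fun m hm hmn _ => ?_
            exact hK _ (sub_ne_zero.2 hmn.symm)
      _ = ENNReal.ofReal (X * T + Y * (1 - u + T)) := by
          rw [ENNReal.tsum_mul_right, ENNReal.tsum_mul_right, hXe, hYe, zero_add,
            ← ENNReal.ofReal_mul hX0, ← ENNReal.ofReal_mul hY0, ← ENNReal.ofReal_add]
          · positivity
          · exact mul_nonneg hY0 (by linarith)
  by_contra! hle
  nlinarith

/-- If `S ⊆ ℤ` has step at least `d`, `0 < r < 1/2`, and either
`r < 1/10` with `d > (5/r)·log(1/r)`, or `d > 10` with `r > (5/d)·log d`,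
then every summable `z : ℤ → ℂ`, not identically zero, whose Fourier series
`ẑ(t) = ∑ z_n e^{2πint}` vanishes for all `|t| ≤ r`, satisfies
`∑_{n∉S}|z_n| > ∑_{n∈S}|z_n|`. -/
theorem stmt_6 (S : Set ℤ) (d : ℝ)
    (hstep : ∀ s ∈ S, ∀ s' ∈ S, s ≠ s' → d ≤ |((s : ℝ) - (s' : ℝ))|)
    (r : ℝ) (hr0 : 0 < r) (hr2 : r < 1 / 2)
    (hcond : (r < 1 / 10 ∧ d > 5 / r * Real.log (1 / r)) ∨
             (d > 10 ∧ r > 5 / d * Real.log d))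
    (z : ℤ → ℂ) (hz : Summable fun n => ‖z n‖) (hz0 : z ≠ 0)
    (hvanish : ∀ t : ℝ, |t| ≤ r →
      (∑' n : ℤ, z n * Complex.exp (2 * Real.pi * Complex.I * (n : ℂ) * (t : ℂ))) = 0) :
    (∑' n : S, ‖z (n : ℤ)‖) < ∑' n : ↥Sᶜ, ‖z (n : ℤ)‖ := by
  obtain ⟨hd, p, hp, hprd, hpr⟩ := exists_natCast_scale hr0 hcond
  have hp11 : (11 : ℝ) ≤ p := by exact_mod_cast hp
  have hp0 : (0 : ℝ) < p := by linarith
  have hpi3 := pi_gt_three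
  set y₀ := 2 * π * (r / p) with hy₀
  have hy₀0 : 0 < y₀ := by positivity
  have hy₀1 : y₀ ≤ 1 / 2 := by
    have : r / p ≤ 1 / 22 := by rw [div_le_iff₀ hp0]; linarith
    nlinarith [pi_lt_four, div_pos hr0 hp0]
  have hu1 : y₀ ^ 2 / 9 ≤ 1 := by nlinarith
  refine tsum_norm_lt_tsum_norm_compl hd hstep hz hz0
    (K := fun x => sinc (y₀ * x) ^ p) (by simp) (Q := (1 / 3) ^ p) (u := y₀ ^ 2 / 9)
    hu1 (fun x hx => ?_) (by positivity) (fun x j hj hjx => ?_) ?_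
    (tsum_mul_sinc_pow_shift_eq_zero hz hr0 hvanish (by omega))
  · have hx1 : (1 : ℝ) ≤ |(x : ℝ)| := by exact_mod_cast Int.one_le_abs hx
    rw [abs_pow]
    refine (pow_le_of_le_one (abs_nonneg _) (abs_sinc_le_one _) (by omega)).trans ?_
    refine abs_sinc_le_of_le hy₀0 hy₀1 ?_
    rw [abs_mul, abs_of_pos hy₀0]
    exact le_mul_of_one_le_right hy₀0.le hx1
  · have hj1 : (1 : ℝ) ≤ |(j : ℝ)| := by exact_mod_cast Int.one_le_abs hj
    have hle : 3 * |(j : ℝ)| ≤ |y₀ * x| := by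
      have h1 : 1 ≤ r * d / p := (one_le_div hp0).2 hprd
      rw [abs_mul, abs_of_pos hy₀0]
      calc 3 * |(j : ℝ)| ≤ π * |(j : ℝ)| * (r * d / p) := by
            rw [← mul_one (3 * |(j : ℝ)|)]
            gcongr
        _ = y₀ * (|(j : ℝ)| * d / 2) := by rw [hy₀]; ring
        _ ≤ y₀ * |(x : ℝ)| := by gcongr
    have hne : y₀ * x ≠ 0 := abs_pos.1 (by linarith)
    rw [abs_pow, ← sq_abs (j : ℝ)]
    calc |sinc (y₀ * x)| ^ p ≤ ((3 * |(j : ℝ)|)⁻¹) ^ p := by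
          gcongr
          exact (abs_sinc_le_inv_abs hne).trans (inv_anti₀ (by positivity) hle)
      _ = (1 / 3) ^ p / |(j : ℝ)| ^ p := by rw [mul_inv, mul_pow, one_div, inv_pow |(j : ℝ)|]; rfl
      _ ≤ (1 / 3) ^ p / |(j : ℝ)| ^ 2 := by
          gcongr
          omega
  · have h4 : 4 * (p : ℝ) ^ 2 ≤ 2 ^ p := by exact_mod_cast four_mul_sq_le_two_pow (by omega : 8 ≤ p)
    have h23 : (2 / 3 : ℝ) ^ (p + 1) = 2 / 3 * (2 ^ p * (1 / 3) ^ p) := by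
      rw [pow_succ, ← mul_pow]; ring_nf
    have hlt : 3 / 2 * (p : ℝ) ^ 2 * (1 / 3) ^ p < r ^ 2 := by
      refine lt_of_lt_of_le ?_ hpr
      rw [h23]
      have h3 : (0 : ℝ) < (1 / 3) ^ p := by positivity
      nlinarith [mul_le_mul_of_nonneg_right h4 h3.le, mul_pos (pow_pos hp0 2) h3]
    have hr : y₀ ^ 2 / 9 = 4 * π ^ 2 / (9 * p ^ 2) * r ^ 2 := by rw [hy₀]; field_simp; ring
    rw [hr]
    calc 2 * ((1 / 3) ^ p * (π ^ 2 / 3))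
        = 4 * π ^ 2 / (9 * p ^ 2) * (3 / 2 * (p : ℝ) ^ 2 * (1 / 3) ^ p) := by field_simp; ring
      _ < _ := by gcongr
end

section
/- Let S ⊆ ℤ have step at least d (i.e. |s − s'| ≥ d for all distinct s, s' ∈ S) and let a be a real number with 10 ≤ a < d. Then for every s ∈ S, ∑_{s'∈S, s'≠s} e^{−π(s'−s)²/a²} ≤ 2·e^{−πd²/(4a²)}. -/
/-- The Gaussian at scale `a` decays at least geometrically along multiples of `d`. -/
lemma gaussian_le_pow {a d x : ℝ} (ha : 0 < a) (had : a < d) {k : ℕ} (hx : k * d ≤ |x|) :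
    Real.exp (-Real.pi * x ^ 2 / a ^ 2) ≤ Real.exp (-Real.pi * d ^ 2 / a ^ 2) ^ k := by
  have hk : (k : ℝ) ≤ (k : ℝ) ^ 2 := by exact_mod_cast Nat.le_self_pow two_ne_zero k
  have hsq : k * d ^ 2 ≤ x ^ 2 := by
    have h : (k * d) ^ 2 ≤ |x| ^ 2 :=
      pow_le_pow_left₀ (mul_nonneg k.cast_nonneg (ha.trans had).le) hx 2
    rw [sq_abs, mul_pow] at h
    exact (mul_le_mul_of_nonneg_right hk (sq_nonneg d)).trans h
  rw [← Real.exp_nat_mul, Real.exp_le_exp, ← mul_div_assoc]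
  refine div_le_div_of_nonneg_right ?_ (sq_nonneg a)
  nlinarith [mul_le_mul_of_nonneg_left hsq Real.pi_pos.le]

lemma exp_neg_pi_mul_sq_div_le_half {a d : ℝ} (ha : 0 < a) (had : a < d) :
    Real.exp (-Real.pi * d ^ 2 / (4 * a ^ 2)) ≤ 1 / 2 := by
  have h2 : (2 : ℝ) ≤ Real.exp (3 / 4) := by
    have h := Real.quadratic_le_exp_of_nonneg (x := 3 / 4) (by norm_num)
    norm_num at h
    linarith
  have hle : -Real.pi * d ^ 2 / (4 * a ^ 2) ≤ -(3 / 4) := by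
    rw [div_le_iff₀ (by positivity)]
    nlinarith [Real.pi_gt_three, pow_le_pow_left₀ ha.le had.le 2, sq_nonneg d]
  calc Real.exp (-Real.pi * d ^ 2 / (4 * a ^ 2)) ≤ Real.exp (-(3 / 4)) := Real.exp_le_exp.2 hle
    _ = (Real.exp (3 / 4))⁻¹ := Real.exp_neg _
    _ ≤ 1 / 2 := by rw [one_div]; exact inv_anti₀ two_pos h2

/-- Two reals of the same sign whose absolute values have the same integer part in units of `d`
are at distance less than `d`. -/
lemma abs_sub_lt_of_floor_eq {d x y : ℝ} (hd : 0 < d) (hxy : 0 < x ↔ 0 < y)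
    (h : ⌊|x| / d⌋₊ = ⌊|y| / d⌋₊) : |x - y| < d := by
  have hx := Nat.floor_le (div_nonneg (abs_nonneg x) hd.le)
  have hy := Nat.floor_le (div_nonneg (abs_nonneg y) hd.le)
  have hx' := Nat.lt_floor_add_one (|x| / d)
  have hy' := Nat.lt_floor_add_one (|y| / d)
  rw [h] at hx hx'
  generalize ⌊|y| / d⌋₊ = n at hx hx' hy hy'
  rw [le_div_iff₀ hd] at hx hy
  rw [div_lt_iff₀ hd] at hx' hy'
  by_cases hp : 0 < x
  · rw [abs_of_pos hp] at hx hx'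
    rw [abs_of_pos (hxy.1 hp)] at hy hy'
    rw [abs_lt]
    constructor <;> linarith
  · rw [abs_of_nonpos (not_lt.1 hp)] at hx hx'
    rw [abs_of_nonpos (not_lt.1 (mt hxy.2 hp))] at hy hy'
    rw [abs_lt]
    constructor <;> linarith

/-- If `S ⊆ ℤ` has step at least `d` and `10 ≤ a < d`, then for every `s ∈ S`,
`∑_{s'∈S, s'≠s} e^{−π(s'−s)²/a²} ≤ 2·e^{−πd²/(4a²)}`. -/
theorem stmt_7 (S : Set ℤ) (d : ℝ)
    (hstep : ∀ s ∈ S, ∀ s' ∈ S, s ≠ s' → d ≤ |((s : ℝ) - (s' : ℝ))|)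
    (a : ℝ) (ha : 10 ≤ a) (had : a < d) (s : ℤ) (hs : s ∈ S) :
    (∑' s' : {s' : ℤ // s' ∈ S ∧ s' ≠ s},
        Real.exp (-Real.pi * (((s' : ℤ) - s : ℤ) : ℝ) ^ 2 / a ^ 2)) ≤
      2 * Real.exp (-Real.pi * d ^ 2 / (4 * a ^ 2)) := by
  have ha0 : 0 < a := by linarith
  have hd : 0 < d := ha0.trans had
  set r := Real.exp (-Real.pi * d ^ 2 / (4 * a ^ 2)) with hr
  have hr0 : 0 < r := Real.exp_pos _
  have hr2 : r ≤ 1 / 2 := exp_neg_pi_mul_sq_div_le_half ha0 had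
  have hq : Real.exp (-Real.pi * d ^ 2 / a ^ 2) = r ^ 4 := by
    rw [hr, ← Real.exp_nat_mul]
    congr 1
    push_cast
    field_simp
  have hr3 : r ^ 3 ≤ 1 / 8 := by
    have := pow_le_pow_left₀ hr0.le hr2 3
    norm_num at this ⊢
    exact this
  have hr4 : r ^ 4 ≤ 1 / 16 := by
    have := pow_le_pow_left₀ hr0.le hr2 4
    norm_num at this ⊢
    exact this
  have hr1 : r ^ 4 < 1 := by linarith
  have hgeom : HasSum (fun n : ℕ => (r ^ 4) ^ (n + 1)) (r ^ 4 * (1 - r ^ 4)⁻¹) := by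
    simpa only [pow_succ' (r ^ 4)] using
      (hasSum_geometric_of_lt_one (by positivity) hr1).mul_left (r ^ 4)
  let g : ℕ ⊕ ℕ → ℝ := Sum.elim (fun n => (r ^ 4) ^ (n + 1)) (fun n => (r ^ 4) ^ (n + 1))
  have hg : HasSum g (r ^ 4 * (1 - r ^ 4)⁻¹ + r ^ 4 * (1 - r ^ 4)⁻¹) :=
    HasSum.sum (f := g) hgeom hgeom
  let k : {s' : ℤ // s' ∈ S ∧ s' ≠ s} → ℕ := fun t => ⌊|((t.1 - s : ℤ) : ℝ)| / d⌋₊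
  have hk (t) : 1 ≤ k t := by
    refine Nat.le_floor ?_
    rw [le_div_iff₀ hd]
    push_cast
    linarith [hstep _ t.2.1 s hs t.2.2]
  let i : {s' : ℤ // s' ∈ S ∧ s' ≠ s} → ℕ ⊕ ℕ := fun t =>
    if 0 < ((t.1 - s : ℤ) : ℝ) then Sum.inl (k t - 1) else Sum.inr (k t - 1)
  have hi : Function.Injective i := by
    intro t u h
    have key : (0 < ((t.1 - s : ℤ) : ℝ) ↔ 0 < ((u.1 - s : ℤ) : ℝ)) ∧ k t = k u := by
      have h1 := hk t
      have h2 := hk u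
      simp only [i] at h
      split_ifs at h with p q q
      · exact ⟨iff_of_true p q, by have := Sum.inl.inj h; omega⟩
      · exact ⟨iff_of_false p q, by have := Sum.inr.inj h; omega⟩
    have hlt := abs_sub_lt_of_floor_eq hd key.1 key.2
    by_contra hne
    have hle := hstep _ t.2.1 _ u.2.1 (fun h' => hne (Subtype.ext h'))
    push_cast at hlt
    rw [sub_sub_sub_cancel_right] at hlt
    linarith
  have hfg (t : {s' : ℤ // s' ∈ S ∧ s' ≠ s}) :
      Real.exp (-Real.pi * (((t : ℤ) - s : ℤ) : ℝ) ^ 2 / a ^ 2) ≤ g (i t) := by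
    have hgi : g (i t) = (r ^ 4) ^ k t := by
      simp only [i]
      split_ifs <;> simp only [g, Sum.elim_inl, Sum.elim_inr, Nat.sub_add_cancel (hk t)]
    rw [hgi, ← hq]
    refine gaussian_le_pow ha0 had ?_
    rw [← le_div_iff₀ hd]
    exact Nat.floor_le (div_nonneg (abs_nonneg _) hd.le)
  have hg0 (c) : 0 ≤ g c := by
    rcases c with n | n <;> simp only [g, Sum.elim_inl, Sum.elim_inr] <;> positivity
  have hf := Summable.of_nonneg_of_le (fun t => (Real.exp_pos _).le) hfg
    (hg.summable.comp_injective hi)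
  have hsum := hf.tsum_le_tsum_of_inj i hi (fun c _ => hg0 c) hfg hg.summable
  rw [hg.tsum_eq] at hsum
  have hfin : r ^ 4 * (1 - r ^ 4)⁻¹ ≤ r := by
    rw [← div_eq_mul_inv, div_le_iff₀ (by linarith)]
    nlinarith
  linarith
end

section
/- Let S ⊆ ℤ have step at least d (i.e. |s − s'| ≥ d for all distinct s, s' ∈ S) and let a be a real number with 10 ≤ a < d. Then for every n ∈ ℤ with n ∉ S, ∑_{s∈S} e^{−π(n−s)²/a²} ≤ 1 − 3π/(4a²) + 2·e^{−πd²/(4a²)}. -/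
/-- A finite set of integers above `x ≥ 0` with step at least `d` has Gaussian sum at most a geometric
series starting with the value at `x`. -/
lemma sum_gaussian_le_of_step (F : Finset ℤ) {d a x : ℝ} (hd : 0 < d) (ha : 0 < a) (hx : 0 ≤ x)
    (hstep : ∀ s ∈ F, ∀ t ∈ F, s ≠ t → d ≤ |(s : ℝ) - t|) (hF : ∀ t ∈ F, x ≤ t) :
    ∑ t ∈ F, Real.exp (-Real.pi * (t : ℝ) ^ 2 / a ^ 2) ≤
      Real.exp (-Real.pi * x ^ 2 / a ^ 2) * (1 - Real.exp (-Real.pi * d ^ 2 / a ^ 2))⁻¹ := by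
  set r := Real.exp (-Real.pi * d ^ 2 / a ^ 2) with hr
  have hr0 : 0 ≤ r := (Real.exp_pos _).le
  have hr1 : r < 1 := by
    rw [hr, Real.exp_lt_one_iff, neg_mul, neg_div, neg_lt_zero]
    positivity
  let j : ℤ → ℕ := fun t => ⌊((t : ℝ) - x) / d⌋₊
  have hle : ∀ t ∈ F, x + j t * d ≤ t := fun t ht => by
    have h := Nat.floor_le (div_nonneg (sub_nonneg.2 (hF t ht)) hd.le)
    rw [le_div_iff₀ hd] at h
    linarith
  have hlt : ∀ t : ℤ, (t : ℝ) < x + (j t + 1) * d := fun t => by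
    have h := Nat.lt_floor_add_one (((t : ℝ) - x) / d)
    rw [div_lt_iff₀ hd] at h
    linarith
  have hinj : Set.InjOn j F := by
    intro s hs t ht hst
    by_contra hne
    have h := hstep s hs t ht hne
    have h1 := hle s hs
    have h2 := hle t ht
    have h3 := hlt s
    have h4 := hlt t
    rw [hst] at h1 h3
    refine absurd h (not_le.2 (abs_lt.2 ⟨?_, ?_⟩)) <;> linarith
  have hterm : ∀ t ∈ F, Real.exp (-Real.pi * (t : ℝ) ^ 2 / a ^ 2) ≤
      Real.exp (-Real.pi * x ^ 2 / a ^ 2) * r ^ j t := fun t ht => by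
    rw [hr, ← Real.exp_nat_mul, ← Real.exp_add, Real.exp_le_exp, mul_div_assoc', ← add_div]
    refine div_le_div_of_nonneg_right ?_ (by positivity)
    have hj : (j t : ℝ) ≤ (j t : ℝ) ^ 2 := mod_cast Nat.le_self_pow two_ne_zero _
    have hsq : (x + j t * d) ^ 2 ≤ (t : ℝ) ^ 2 :=
      pow_le_pow_left₀ (by positivity) (hle t ht) 2
    have hcross : 0 ≤ x * (j t * d) := by positivity
    have hjd : (j t : ℝ) * d ^ 2 ≤ (j t : ℝ) ^ 2 * d ^ 2 :=
      mul_le_mul_of_nonneg_right hj (by positivity)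
    have key : x ^ 2 + j t * d ^ 2 ≤ (t : ℝ) ^ 2 := by linarith
    have := mul_le_mul_of_nonneg_left key Real.pi_pos.le
    linarith
  calc ∑ t ∈ F, Real.exp (-Real.pi * (t : ℝ) ^ 2 / a ^ 2)
      ≤ ∑ t ∈ F, Real.exp (-Real.pi * x ^ 2 / a ^ 2) * r ^ j t := Finset.sum_le_sum hterm
    _ = Real.exp (-Real.pi * x ^ 2 / a ^ 2) * ∑ i ∈ F.image j, r ^ i := by
      rw [← Finset.mul_sum, Finset.sum_image hinj]
    _ ≤ Real.exp (-Real.pi * x ^ 2 / a ^ 2) * (1 - r)⁻¹ := by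
      refine mul_le_mul_of_nonneg_left ?_ (Real.exp_pos _).le
      rw [← tsum_geometric_of_lt_one hr0 hr1]
      exact (summable_geometric_of_lt_one hr0 hr1).sum_le_tsum _ fun i _ => pow_nonneg hr0 i

/-- The geometric majorants started at `1` and at `d / 2` stay below the target bound. -/
lemma gaussian_majorants_add_le {a d : ℝ} (ha : 10 ≤ a) (had : a < d) :
    Real.exp (-Real.pi * 1 ^ 2 / a ^ 2) * (1 - Real.exp (-Real.pi * d ^ 2 / a ^ 2))⁻¹ +
      Real.exp (-Real.pi * (d / 2) ^ 2 / a ^ 2) * (1 - Real.exp (-Real.pi * d ^ 2 / a ^ 2))⁻¹ ≤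
      1 - 3 * Real.pi / (4 * a ^ 2) + 2 * Real.exp (-Real.pi * d ^ 2 / (4 * a ^ 2)) := by
  have ha0 : 0 < a := by linarith
  have hpi := Real.pi_gt_three
  have hpi4 := Real.pi_le_four
  set g := Real.exp (-Real.pi * d ^ 2 / (4 * a ^ 2)) with hg
  have hg0 : 0 < g := Real.exp_pos _
  have hg4 : Real.exp (-Real.pi * d ^ 2 / a ^ 2) = g ^ 4 := by
    rw [hg, ← Real.exp_nat_mul]
    congr 1
    push_cast
    field_simp
  have hghalf : Real.exp (-Real.pi * (d / 2) ^ 2 / a ^ 2) = g := by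
    rw [hg]
    congr 1
    field_simp
    ring
  have hg1 : g ≤ 4 / 7 := by
    have h1 : 3 / 4 ≤ Real.pi * d ^ 2 / (4 * a ^ 2) := by
      rw [div_le_div_iff₀ (by norm_num) (by positivity)]
      have : a ^ 2 ≤ d ^ 2 := pow_le_pow_left₀ ha0.le had.le 2
      nlinarith [sq_nonneg d]
    have h2 : 7 / 4 ≤ Real.exp (Real.pi * d ^ 2 / (4 * a ^ 2)) := by
      linarith [Real.add_one_le_exp (Real.pi * d ^ 2 / (4 * a ^ 2))]
    rw [hg, neg_mul, neg_div, Real.exp_neg]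
    calc _ ≤ (7 / 4 : ℝ)⁻¹ := inv_anti₀ (by norm_num) h2
      _ = 4 / 7 := by norm_num
  set u := Real.pi / a ^ 2 with hu
  have hu0 : 0 < u := by positivity
  have hu1 : u ≤ 1 / 25 := by
    rw [hu, div_le_div_iff₀ (by positivity) (by norm_num)]
    nlinarith
  have he : Real.exp (-Real.pi * 1 ^ 2 / a ^ 2) ≤ 1 - 3 / 4 * u := by
    have h1 : -Real.pi * 1 ^ 2 / a ^ 2 = -u := by rw [hu]; ring
    have h2 := Real.add_one_le_exp u
    rw [h1, Real.exp_neg]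
    calc _ ≤ (1 + u)⁻¹ := inv_anti₀ (by linarith) (by linarith)
      _ ≤ 1 - 3 / 4 * u := by
        rw [inv_le_iff_one_le_mul₀ (by linarith)]
        nlinarith
  have h3u : 3 * Real.pi / (4 * a ^ 2) = 3 / 4 * u := by rw [hu]; field_simp
  have hg3 : g ^ 3 ≤ 64 / 343 :=
    (pow_le_pow_left₀ hg0.le hg1 3).trans (by norm_num)
  have hg4' : g ^ 4 ≤ 64 / 343 * g := by
    rw [pow_succ]
    exact mul_le_mul_of_nonneg_right hg3 hg0.le
  rw [hg4, hghalf, h3u, ← add_mul, ← div_eq_mul_inv, div_le_iff₀ (by linarith)]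
  have hc : g ^ 4 * (1 - 3 / 4 * u + 2 * g) ≤ 64 / 343 * g * 3 :=
    mul_le_mul hg4' (by linarith) (by linarith) (by positivity)
  linarith

/-- If `S ⊆ ℤ` has step at least `d` and `10 ≤ a < d`, then for every `n ∉ S`,
`∑_{s∈S} e^{−π(n−s)²/a²} ≤ 1 − 3π/(4a²) + 2·e^{−πd²/(4a²)}`. -/
theorem stmt_8 (S : Set ℤ) (d : ℝ)
    (hstep : ∀ s ∈ S, ∀ s' ∈ S, s ≠ s' → d ≤ |((s : ℝ) - (s' : ℝ))|)
    (a : ℝ) (ha : 10 ≤ a) (had : a < d) (n : ℤ) (hn : n ∉ S) :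
    (∑' s : S, Real.exp (-Real.pi * ((n - (s : ℤ) : ℤ) : ℝ) ^ 2 / a ^ 2)) ≤
      1 - 3 * Real.pi / (4 * a ^ 2) + 2 * Real.exp (-Real.pi * d ^ 2 / (4 * a ^ 2)) := by
  have ha0 : 0 < a := by linarith
  have hd0 : 0 < d := by linarith
  refine Real.tsum_le_of_sum_le (fun _ => (Real.exp_pos _).le) fun G => ?_
  let A : Finset ℤ := (G.image fun s : S => (s : ℤ) - n).filter (0 < ·)
  let B : Finset ℤ := (G.image fun s : S => n - (s : ℤ)).filter (0 < ·)
  have hA : ∀ t ∈ A, n + t ∈ S ∧ 0 < t := by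
    intro t ht
    simp only [A, Finset.mem_filter, Finset.mem_image] at ht
    obtain ⟨⟨s, -, rfl⟩, h⟩ := ht
    exact ⟨by simp, h⟩
  have hB : ∀ t ∈ B, n - t ∈ S ∧ 0 < t := by
    intro t ht
    simp only [B, Finset.mem_filter, Finset.mem_image] at ht
    obtain ⟨⟨s, -, rfl⟩, h⟩ := ht
    exact ⟨by simp, h⟩
  have hsplit : ∑ s ∈ G, Real.exp (-Real.pi * ((n - (s : ℤ) : ℤ) : ℝ) ^ 2 / a ^ 2) =
      ∑ t ∈ A, Real.exp (-Real.pi * (t : ℝ) ^ 2 / a ^ 2) +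
        ∑ t ∈ B, Real.exp (-Real.pi * (t : ℝ) ^ 2 / a ^ 2) := by
    have hne : ∀ s ∈ G, ¬ 0 < (s : ℤ) - n ↔ 0 < n - (s : ℤ) := fun s _ => by
      have : (s : ℤ) ≠ n := fun h => hn (h ▸ s.2)
      lia
    rw [← Finset.sum_filter_add_sum_filter_not G fun s : S => 0 < (s : ℤ) - n,
      Finset.filter_congr hne]
    simp only [A, B, Finset.filter_image]
    rw [Finset.sum_image fun s _ t _ h => Subtype.ext (by simpa using h),
      Finset.sum_image fun s _ t _ h => Subtype.ext (by simpa using h)]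
    congr 1
    refine Finset.sum_congr rfl fun s _ => ?_
    push_cast
    ring_nf
  have hAstep : ∀ s ∈ A, ∀ t ∈ A, s ≠ t → d ≤ |(s : ℝ) - t| := fun s hs t ht hst => by
    have h := hstep _ (hA s hs).1 _ (hA t ht).1 (by lia)
    push_cast at h
    rwa [add_sub_add_left_eq_sub] at h
  have hBstep : ∀ s ∈ B, ∀ t ∈ B, s ≠ t → d ≤ |(s : ℝ) - t| := fun s hs t ht hst => by
    have h := hstep _ (hB s hs).1 _ (hB t ht).1 (by lia)
    push_cast at h
    rwa [sub_sub_sub_cancel_left, abs_sub_comm] at h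
  have hA1 : ∀ t ∈ A, (1 : ℝ) ≤ t := fun t ht => mod_cast (hA t ht).2
  have hB1 : ∀ t ∈ B, (1 : ℝ) ≤ t := fun t ht => mod_cast (hB t ht).2
  have hfar : (∀ t ∈ A, d / 2 ≤ (t : ℝ)) ∨ ∀ t ∈ B, d / 2 ≤ (t : ℝ) := by
    by_contra! h
    obtain ⟨⟨s, hs, hs2⟩, t, ht, ht2⟩ := h
    have hs0 := hA1 s hs
    have ht0 := hB1 t ht
    have h := hstep _ (hA s hs).1 _ (hB t ht).1 (by have := hA s hs; have := hB t ht; lia)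
    push_cast at h
    rw [abs_of_nonneg (by linarith)] at h
    linarith
  have hmaj := gaussian_majorants_add_le ha had
  rw [hsplit]
  rcases hfar with h | h
  · have h1 := sum_gaussian_le_of_step A hd0 ha0 (by positivity) hAstep h
    have h2 := sum_gaussian_le_of_step B hd0 ha0 zero_le_one hBstep hB1
    linarith
  · have h1 := sum_gaussian_le_of_step A hd0 ha0 zero_le_one hAstep hA1
    have h2 := sum_gaussian_le_of_step B hd0 ha0 (by positivity) hBstep h
    linarith
end

section
/- Let a ≥ 10 and let r be a real number with (2/a)·√(log a) < r ≤ 1/2. Then 2·∑_{m∈ℤ} a·e^{−πa²(r−m)²} ≤ π/(8a²). -/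
theorem gaussian_le_geometric {a r t s : ℝ} (n : ℕ) (ha : 1 ≤ a)
    (hr : 4 * Real.log a ≤ a ^ 2 * r ^ 2) (hs : 0 ≤ s) (hn : (n : ℝ) - 1 ≤ s)
    (ht : r ^ 2 + s ≤ t ^ 2) :
    a * Real.exp (-Real.pi * a ^ 2 * t ^ 2) ≤ 2 * (a ^ 11)⁻¹ * (1 / 2) ^ n := by
  have ha0 : 0 < a := by linarith
  have hlog : 0 ≤ Real.log a := Real.log_nonneg ha
  have hl2 : 0 < Real.log 2 := Real.log_pos (by norm_num)
  have hl2' : Real.log 2 ≤ 1 := by linarith [Real.log_two_lt_d9]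
  have hpi := Real.pi_gt_three
  have hexp : -Real.pi * a ^ 2 * t ^ 2 ≤ -(12 * Real.log a) + (1 - n) * Real.log 2 := by
    have h1 : 12 * Real.log a ≤ Real.pi * (a ^ 2 * r ^ 2) := by nlinarith
    have h2 : (n - 1) * Real.log 2 ≤ s * 1 :=
      (mul_le_mul_of_nonneg_right hn hl2.le).trans (mul_le_mul_of_nonneg_left hl2' hs)
    have h3 : 1 ≤ Real.pi * a ^ 2 := by nlinarith
    have h4 : s * 1 ≤ s * (Real.pi * a ^ 2) := mul_le_mul_of_nonneg_left h3 hs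
    have h5 := mul_le_mul_of_nonneg_left ht (zero_le_one.trans h3)
    linarith
  have hval : Real.exp (-(12 * Real.log a) + (1 - n) * Real.log 2) =
      (a ^ 12)⁻¹ * (2 * (1 / 2) ^ n) := by
    rw [Real.exp_add, Real.exp_neg, sub_mul, one_mul, Real.exp_sub, Real.exp_log two_pos,
      Real.exp_nat_mul, Real.exp_log two_pos, show (12 : ℝ) = ((12 : ℕ) : ℝ) by norm_num,
      Real.exp_nat_mul, Real.exp_log ha0, one_div, inv_pow, div_eq_mul_inv]
  calc a * Real.exp (-Real.pi * a ^ 2 * t ^ 2)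
      ≤ a * ((a ^ 12)⁻¹ * (2 * (1 / 2) ^ n)) := by
        rw [← hval]
        gcongr
    _ = 2 * (a ^ 11)⁻¹ * (1 / 2) ^ n := by field_simp

/-- For `a ≥ 10` and `(2/a)·√(log a) < r ≤ 1/2`, twice the periodized Gaussian
`γ*_a(r) = ∑_{m∈ℤ} a·e^{−πa²(r−m)²}` is at most `π/(8a²)`. -/
theorem stmt_10 (a r : ℝ) (ha : 10 ≤ a)
    (hr1 : 2 / a * Real.sqrt (Real.log a) < r) (hr2 : r ≤ 1 / 2) :
    2 * (∑' m : ℤ, a * Real.exp (-Real.pi * a ^ 2 * (r - (m : ℝ)) ^ 2)) ≤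
      Real.pi / (8 * a ^ 2) := by
  have ha0 : 0 < a := by linarith
  have ha1 : 1 ≤ a := by linarith
  have hlog : 0 ≤ Real.log a := Real.log_nonneg ha1
  have hr0 : 0 < r := lt_of_le_of_lt (by positivity) hr1
  have hr : 4 * Real.log a ≤ a ^ 2 * r ^ 2 := by
    have h1 : 2 * Real.sqrt (Real.log a) ≤ a * r := by
      have := mul_le_mul_of_nonneg_left hr1.le ha0.le
      rwa [← mul_assoc, mul_div_cancel₀ _ ha0.ne'] at this
    have h2 := pow_le_pow_left₀ (by positivity) h1 2
    rwa [mul_pow, Real.sq_sqrt hlog, mul_pow, show (2 : ℝ) ^ 2 = 4 by norm_num] at h2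
  set f : ℤ → ℝ := fun m => a * Real.exp (-Real.pi * a ^ 2 * (r - (m : ℝ)) ^ 2) with hf
  have hf0 : ∀ m, 0 ≤ f m := fun m => by positivity
  have hpos : ∀ n : ℕ, f n ≤ 2 * (a ^ 11)⁻¹ * (1 / 2) ^ n := by
    rintro (_ | n)
    · exact gaussian_le_geometric 0 ha1 hr le_rfl (by norm_num) (by simp)
    · have hn : (n : ℝ) ≤ n ^ 2 := by exact_mod_cast Nat.le_self_pow two_ne_zero n
      refine gaussian_le_geometric (n + 1) ha1 hr n.cast_nonneg (by simp) ?_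
      push_cast
      nlinarith [n.cast_nonneg (α := ℝ)]
  have hneg : ∀ n : ℕ, f (-(n + 1)) ≤ 2 * (a ^ 11)⁻¹ * (1 / 2) ^ n := by
    intro n
    have hn : (0 : ℝ) ≤ n := n.cast_nonneg
    refine gaussian_le_geometric n ha1 hr hn (by simp) ?_
    push_cast
    nlinarith [mul_nonneg hr0.le hn]
  have hgeom : HasSum (fun n : ℕ => 2 * (a ^ 11)⁻¹ * (1 / 2 : ℝ) ^ n) (2 * (a ^ 11)⁻¹ * 2) :=
    hasSum_geometric_two.mul_left _
  have hs1 : Summable fun n : ℕ => f n := .of_nonneg_of_le (fun _ => hf0 _) hpos hgeom.summable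
  have hs2 : Summable fun n : ℕ => f (-(n + 1)) :=
    .of_nonneg_of_le (fun _ => hf0 _) hneg hgeom.summable
  have hle1 := hs1.tsum_le_tsum hpos hgeom.summable
  have hle2 := hs2.tsum_le_tsum hneg hgeom.summable
  rw [hgeom.tsum_eq] at hle1 hle2
  rw [tsum_of_nat_of_neg_add_one hs1 hs2]
  have hfinal : 16 * (a ^ 11)⁻¹ ≤ Real.pi / (8 * a ^ 2) := by
    have h9 : (10 : ℝ) ^ 9 ≤ a ^ 9 := pow_le_pow_left₀ (by norm_num) ha 9
    rw [← div_eq_mul_inv, div_le_div_iff₀ (by positivity) (by positivity)]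
    have h : 128 ≤ Real.pi * a ^ 9 := by nlinarith [Real.pi_gt_three]
    nlinarith [mul_le_mul_of_nonneg_right h (sq_nonneg a)]
  linarith
end
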